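/- ∫₀¹ sin(2πx) · log Γ(x+1) dx = Ci(2π)/(2π), where Ci is the cosine integral function. -/

import Mathlib

open MeasureTheory Real

/-- The cosine integral `Ci(x) = γ + log x + ∫₀^x (cos t − 1)/t dt`
(equivalently `−∫_x^∞ (cos t)/t dt` for `x > 0`). -/
noncomputable def Ci (x : ℝ) : ℝ :=
  Real.eulerMascheroniConstant + Real.log x + ∫ t in (0:ℝ)..x, (Real.cos t - 1) / t

noncomputable def hK (u : ℝ) : ℝ := (1 - Real.cos u) / u

noncomputable def gK (t : ℝ) : ℝ := t⁻¹ - Real.cos t / Real.sin t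

lemma hK_cont : Continuous hK := by
  have : hK = fun u => Real.sin (u/2) * Real.sinc (u/2) := by
    funext u
    by_cases hu : u = 0
    · simp [hu, hK]
    · rw [Real.sinc_of_ne_zero (by simpa using hu), hK]
      have h1 : Real.cos u = 1 - 2 * Real.sin (u/2)^2 := by
        have h3 := Real.cos_two_mul (u/2)
        have h2 := Real.sin_sq_add_cos_sq (u/2)
        rw [show 2 * (u/2) = u by ring] at h3
        linarith
      rw [h1]; field_simp; ring
  rw [this]
  have := Real.continuous_sinc
  fun_prop

lemma sinc_pos_K {x : ℝ} (hx : x ∈ Set.Icc 0 (π/2)) : 0 < Real.sinc x := by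
  rcases eq_or_lt_of_le hx.1 with h | h
  · simp [← h]
  · rw [Real.sinc_of_ne_zero h.ne']
    exact div_pos (Real.sin_pos_of_pos_of_lt_pi h (by linarith [hx.2, Real.pi_pos])) h

lemma logsinc_cont : ContinuousOn (fun x => - Real.log (Real.sinc x)) (Set.Icc 0 (π/2)) :=
  (Real.continuous_sinc.continuousOn.log (fun _ hx => (sinc_pos_K hx).ne')).neg

lemma logsinc_deriv : ∀ x ∈ Set.Ioo 0 (π/2),
    HasDerivAt (fun x => - Real.log (Real.sinc x)) (gK x) x := by
  intro x hx
  have hs : 0 < Real.sin x := Real.sin_pos_of_pos_of_lt_pi hx.1 (by linarith [hx.2, Real.pi_pos])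
  have h1 : HasDerivAt (fun x => Real.log x - Real.log (Real.sin x)) (gK x) x :=
    (Real.hasDerivAt_log hx.1.ne').sub ((Real.hasDerivAt_sin x).log hs.ne')
  refine h1.congr_of_eventuallyEq ?_
  filter_upwards [isOpen_Ioo.mem_nhds hx] with y hy
  have hs : 0 < Real.sin y := Real.sin_pos_of_pos_of_lt_pi hy.1 (by linarith [hy.2, Real.pi_pos])
  rw [Real.sinc_of_ne_zero hy.1.ne', Real.log_div hs.ne' hy.1.ne']
  ring

lemma gK_int : IntervalIntegrable gK volume 0 (π/2) := by
  rw [intervalIntegrable_iff_integrableOn_Ioc_of_le (by positivity)]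
  refine intervalIntegral.integrableOn_deriv_of_nonneg logsinc_cont logsinc_deriv ?_
  intro x hx
  have h := Real.lt_tan hx.1 hx.2
  have hs : 0 < Real.sin x := Real.sin_pos_of_pos_of_lt_pi hx.1 (by linarith [hx.2, Real.pi_pos])
  have hc : 0 < Real.cos x := Real.cos_pos_of_mem_Ioo ⟨by linarith [hx.1, Real.pi_pos], hx.2⟩
  rw [Real.tan_eq_sin_div_cos, lt_div_iff₀ hc] at h
  have hx0 := hx.1
  rw [gK, sub_nonneg, div_le_iff₀ hs, inv_mul_eq_div, le_div_iff₀ hx0]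
  linarith

lemma gK_integral : ∫ t in (0:ℝ)..(π/2), gK t = Real.log (π/2) := by
  rw [intervalIntegral.integral_eq_sub_of_hasDerivAt_of_le (by positivity) logsinc_cont
    logsinc_deriv gK_int]
  rw [Real.sinc_of_ne_zero (by positivity), Real.sin_pi_div_two, one_div, Real.log_inv]
  simp

lemma RL : Filter.Tendsto (fun M : ℕ => ∫ t in (0:ℝ)..(π/2), Real.cos (4 * M * t) * gK t)
    Filter.atTop (nhds 0) := by
  have h := Real.tendsto_integral_exp_smul_cocompact
    (fun t => (((Set.Ioc 0 (π/2)).indicator gK t : ℝ) : ℂ))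
  have h2 : Filter.Tendsto (fun M : ℕ => (2 * (M:ℝ) / π)) Filter.atTop (Filter.cocompact ℝ) := by
    have : Filter.Tendsto (fun M : ℕ => (2 * (M:ℝ) / π)) Filter.atTop Filter.atTop :=
      (tendsto_natCast_atTop_atTop.const_mul_atTop (by norm_num)).atTop_div_const Real.pi_pos
    exact this.mono_right atTop_le_cocompact
  have h3 := (Complex.continuous_re.tendsto 0).comp (h.comp h2)
  rw [Complex.zero_re] at h3
  refine h3.congr fun M => ?_
  have hi : Integrable (fun t => (((Set.Ioc 0 (π/2)).indicator gK t : ℝ) : ℂ)) := by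
    refine Integrable.ofReal (f := (Set.Ioc 0 (π/2)).indicator gK) ?_
    rw [integrable_indicator_iff measurableSet_Ioc]
    exact (intervalIntegrable_iff_integrableOn_Ioc_of_le (by positivity)).1 gK_int
  have hi2 := (Real.fourierIntegral_convergent_iff (V := ℝ) (2 * (M:ℝ) / π)).2 hi
  simp only [Function.comp]
  rw [intervalIntegral.integral_of_le (by positivity), ← integral_indicator measurableSet_Ioc]
  have h4 := integral_re (𝕜 := ℂ) (μ := volume) (f := fun v : ℝ => Real.fourierChar (-(v * (2 * (M:ℝ) / π))) •
     (((Set.Ioc 0 (π/2)).indicator gK v : ℝ) : ℂ)) (by simpa [mul_comm] using hi2)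
  simp only [RCLike.re_eq_complex_re] at h4
  rw [← h4]
  congr 1
  funext t
  by_cases ht : t ∈ Set.Ioc 0 (π/2)
  · simp only [ht, Set.indicator_of_mem]
    rw [Circle.smul_def, Real.fourierChar_apply, smul_eq_mul, Complex.re_mul_ofReal,
      Complex.exp_ofReal_mul_I_re]
    congr 1
    rw [← Real.cos_neg]
    congr 1
    field_simp
    ring
  · simp [ht]

lemma cot_sum (t : ℝ) (ht : Real.sin t ≠ 0) (M : ℕ) :
    (1 - Real.cos (4 * M * t)) * (Real.cos t / Real.sin t) =
      ∑ j ∈ Finset.range M, (2 * Real.sin ((4*j+2) * t) + Real.sin ((4*j+4)*t)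
        + Real.sin (4*j*t)) := by
  induction M with
  | zero => simp
  | succ M ih =>
    rw [Finset.sum_range_succ, ← ih]
    push_cast
    have e1 : 4 * ((M:ℝ)+1) * t = (4*M+2)*t + 2*t := by ring
    have e2 : (4 * (M:ℝ)+4) * t = (4*M+2)*t + 2*t := by ring
    have e3 : 4 * (M:ℝ) * t = (4*M+2)*t - 2*t := by ring
    rw [e1, e2, e3, Real.cos_add, Real.cos_sub, Real.sin_add, Real.sin_sub, Real.sin_two_mul,
      Real.cos_two_mul]
    field_simp
    ring

lemma sin_int (c : ℝ) (hc : c ≠ 0) : ∫ t in (0:ℝ)..(π/2), Real.sin (c * t) =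
    (1 - Real.cos (c * (π/2))) / c := by
  rw [intervalIntegral.integral_comp_mul_left _ hc, integral_sin]
  simp; field_simp

lemma cos_nat_pi_K (k : ℕ) : Real.cos (2 * k * π) = 1 := by
  have := Real.cos_nat_mul_two_pi k
  rw [← this]; congr 1; ring

lemma term_int (j : ℕ) : ∫ t in (0:ℝ)..(π/2), (2 * Real.sin ((4*j+2) * t) + Real.sin ((4*j+4)*t)
        + Real.sin (4*j*t)) = 2 / (2*j+1) := by
  have i1 (c : ℝ) : IntervalIntegrable (fun t => Real.sin (c * t)) volume 0 (π/2) :=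
    Continuous.intervalIntegrable (by fun_prop) _ _
  rw [intervalIntegral.integral_add (((i1 _).const_mul 2).add (i1 _)) (i1 _),
    intervalIntegral.integral_add ((i1 _).const_mul 2) (i1 _),
    intervalIntegral.integral_const_mul, sin_int _ (by positivity), sin_int _ (by positivity)]
  have c1 : Real.cos ((4*j+2) * (π/2)) = -1 := by
    rw [show (4*(j:ℝ)+2) * (π/2) = 2 * j * π + π by ring, Real.cos_add_pi, cos_nat_pi_K]
  have c2 : Real.cos ((4*j+4) * (π/2)) = 1 := by
    rw [show (4*(j:ℝ)+4) * (π/2) = 2 * (j+1:ℕ) * π by push_cast; ring, cos_nat_pi_K]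
  have c3 : ∫ t in (0:ℝ)..(π/2), Real.sin (4*j*t) = 0 := by
    rcases Nat.eq_zero_or_pos j with h | h
    · simp [h]
    · rw [sin_int _ (by positivity)]
      rw [show (4*(j:ℝ)) * (π/2) = 2 * j * π by ring, cos_nat_pi_K]; simp
  rw [c1, c2, c3]
  have : (4*(j:ℝ)+2) ≠ 0 := by positivity
  have : (2*(j:ℝ)+1) ≠ 0 := by positivity
  field_simp
  ring

lemma odd_harm (M : ℕ) : ∑ j ∈ Finset.range M, (2:ℝ) / (2*j+1) =
    2 * (harmonic (2*M) : ℝ) - harmonic M := by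
  induction M with
  | zero => simp
  | succ M ih =>
    rw [Finset.sum_range_succ, ih, show 2 * (M+1) = (2*M+1)+1 by ring, harmonic_succ, harmonic_succ,
      harmonic_succ]
    push_cast
    have : (2*(M:ℝ)+1) ≠ 0 := by positivity
    have : (2*(M:ℝ)+1+1) ≠ 0 := by positivity
    have : ((M:ℝ)+1) ≠ 0 := by positivity
    field_simp
    ring

lemma J_eq (M : ℕ) : ∫ u in (0:ℝ)..(2 * π * M), hK u =
    Real.log (π/2) - (∫ t in (0:ℝ)..(π/2), Real.cos (4 * M * t) * gK t) +
      (2 * (harmonic (2*M) : ℝ) - harmonic M) := by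
  have h1 : ∫ u in (0:ℝ)..(2 * π * M), hK u = ∫ t in (0:ℝ)..(π/2), (4*M) * hK (4*M*t) := by
    rw [intervalIntegral.integral_const_mul, intervalIntegral.mul_integral_comp_mul_left]
    congr 1 <;> ring
  have i1 (c : ℝ) : IntervalIntegrable (fun t => Real.sin (c * t)) volume 0 (π/2) :=
    Continuous.intervalIntegrable (by fun_prop) _ _
  have ic : IntervalIntegrable (fun t => Real.cos (4 * M * t) * gK t) volume 0 (π/2) :=
    gK_int.continuousOn_mul (by fun_prop)
  have is : ∀ j ∈ Finset.range M, IntervalIntegrable (fun t => 2 * Real.sin ((4*j+2) * t) +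
      Real.sin ((4*j+4)*t) + Real.sin (4*j*t)) volume 0 (π/2) := fun j _ =>
    Continuous.intervalIntegrable (by fun_prop) _ _
  rw [h1, ← odd_harm, ← gK_integral, ← intervalIntegral.integral_sub gK_int ic]
  simp_rw [← term_int]
  rw [← intervalIntegral.integral_finsetSum is, ← intervalIntegral.integral_add (gK_int.sub ic)]
  · apply intervalIntegral.integral_congr_ae
    refine Filter.Eventually.of_forall fun t ht => ?_
    rw [Set.uIoc_of_le (by positivity)] at ht
    have hs : 0 < Real.sin t := Real.sin_pos_of_pos_of_lt_pi ht.1 (by linarith [ht.2, Real.pi_pos])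
    have ht0 := ht.1.ne'
    beta_reduce
    rw [← cot_sum t hs.ne' M, hK, gK]
    rcases Nat.eq_zero_or_pos M with h | h
    · simp [h]
    · field_simp
      ring
  · exact Continuous.intervalIntegrable (by fun_prop) _ _

lemma J_lim : Filter.Tendsto (fun M : ℕ => (∫ u in (0:ℝ)..(2 * π * M), hK u) - Real.log (2 * π * M))
    Filter.atTop (nhds Real.eulerMascheroniConstant) := by
  have a1 := Real.tendsto_harmonic_sub_log
  have a2 := a1.comp (Filter.tendsto_id.const_mul_atTop' (show 0 < 2 by norm_num))
  have a3 := ((a2.const_mul 2).sub a1).sub RL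
  rw [show 2 * Real.eulerMascheroniConstant - Real.eulerMascheroniConstant - 0 =
    Real.eulerMascheroniConstant by ring] at a3
  refine a3.congr' ?_
  filter_upwards [Filter.eventually_gt_atTop 0] with M hM
  have hM' : (0:ℝ) < M := by exact_mod_cast hM
  rw [J_eq]
  simp only [Function.comp, id]
  push_cast
  rw [Real.log_mul (by positivity) (by positivity), Real.log_mul (by positivity) (by positivity),
    Real.log_mul (by positivity) (by positivity), Real.log_div (by positivity) (by positivity)]
  ring

lemma log_term (m : ℕ) : ∫ x in (0:ℝ)..1, Real.sin (2*π*x) * Real.log (x + (m+1)) =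
    -(1/(2*π)) * ∫ u in (2*π*(m+1:ℕ))..(2*π*(m+1+1:ℕ)), hK u := by
  have h1 : ∫ u in (2*π*(m+1:ℕ))..(2*π*(m+1+1:ℕ)), hK u =
      ∫ x in (0:ℝ)..1, (1 - Real.cos (2*π*x)) / (x + (m+1)) := by
    have e : ∫ u in (2*π*(m+1:ℕ))..(2*π*(m+1+1:ℕ)), hK u =
        ∫ x in (0:ℝ)..1, (2*π) * hK (2*π*x + 2*π*(m+1)) := by
      rw [intervalIntegral.integral_const_mul, intervalIntegral.mul_integral_comp_mul_add]
      congr 1 <;> push_cast <;> ring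
    rw [e]
    apply intervalIntegral.integral_congr
    intro x hx
    rw [Set.uIcc_of_le (by norm_num)] at hx
    have hx0 := hx.1
    have : x + ((m:ℝ)+1) ≠ 0 := by positivity
    simp only [hK]
    have e2 : Real.cos (2*π*x + 2*π*(m+1)) = Real.cos (2*π*x) := by
      have := Real.cos_add_nat_mul_two_pi (2*π*x) (m+1)
      rw [← this]; congr 1; push_cast; ring
    rw [e2, show 2*π*x + 2*π*(m+1) = (2*π)*(x+(m+1)) by ring]
    field_simp
  rw [h1]
  have cl : ContinuousOn (fun x : ℝ => Real.log (x + (m+1))) (Set.uIcc 0 1) := by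
    apply ContinuousOn.log (by fun_prop)
    intro x hx
    rw [Set.uIcc_of_le (by norm_num)] at hx
    have hx0 := hx.1
    positivity
  have j1 : IntervalIntegrable (fun x => Real.sin (2*π*x) * Real.log (x + (m+1))) volume 0 1 :=
    ContinuousOn.intervalIntegrable ((by fun_prop : ContinuousOn (fun x => Real.sin (2*π*x)) _).mul cl)
  have j2 : IntervalIntegrable (fun x => (1 - Real.cos (2*π*x)) / (x + (m+1))) volume 0 1 := by
    apply ContinuousOn.intervalIntegrable
    apply ContinuousOn.div (by fun_prop) (by fun_prop)
    intro x hx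
    rw [Set.uIcc_of_le (by norm_num)] at hx
    have hx0 := hx.1
    positivity
  have key := intervalIntegral.integral_eq_sub_of_hasDerivAt
    (f := fun x : ℝ => (1 - Real.cos (2*π*x)) / (2*π) * Real.log (x + (m+1)))
    (f' := fun x => Real.sin (2*π*x) * Real.log (x + (m+1)) +
      (1/(2*π)) * ((1 - Real.cos (2*π*x)) / (x + (m+1)))) (a := 0) (b := 1) ?_
      (j1.add (j2.const_mul _))
  · rw [intervalIntegral.integral_add j1 (j2.const_mul _), intervalIntegral.integral_const_mul] at key
    simp at key
    simp
    linarith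
  · intro x hx
    rw [Set.uIcc_of_le (by norm_num)] at hx
    have hx0 := hx.1
    have hp : x + ((m:ℝ)+1) ≠ 0 := by positivity
    have d1 : HasDerivAt (fun x : ℝ => 2*π*x) (2*π) x := by
      simpa using (hasDerivAt_id x).const_mul (2*π)
    have d2 := ((d1.cos.const_sub 1).div_const (2*π)).mul
      (((hasDerivAt_id x).add_const ((m:ℝ)+1)).log hp)
    refine d2.congr_deriv ?_
    simp only [id]
    field_simp

lemma x_sin : ∫ x in (0:ℝ)..1, Real.sin (2*π*x) * x = -(1/(2*π)) := by
  have key := intervalIntegral.integral_eq_sub_of_hasDerivAt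
    (f := fun x : ℝ => Real.sin (2*π*x) / (2*π)^2 - x * Real.cos (2*π*x) / (2*π))
    (f' := fun x => Real.sin (2*π*x) * x) (a := 0) (b := 1) ?_
      (Continuous.intervalIntegrable (by fun_prop) _ _)
  · rw [key]; simp
  · intro x hx
    have d1 : HasDerivAt (fun x : ℝ => 2*π*x) (2*π) x := by
      simpa using (hasDerivAt_id x).const_mul (2*π)
    have d2 := (d1.sin.div_const ((2*π)^2)).sub
      (((hasDerivAt_id x).mul d1.cos).div_const (2*π))
    refine d2.congr_deriv ?_
    simp only [id]
    field_simp
    ring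

lemma sin_zero_int : ∫ x in (0:ℝ)..1, Real.sin (2*π*x) = 0 := by
  rw [intervalIntegral.integral_comp_mul_left _ (by positivity), integral_sin]
  simp

noncomputable def GK (n : ℕ) (x : ℝ) : ℝ :=
  x * Real.log n + Real.log n.factorial - ∑ m ∈ Finset.range n, Real.log (x + (m+1))

lemma GK_term_cont (m : ℕ) : ContinuousOn (fun x : ℝ => Real.log (x + (m+1))) (Set.uIcc 0 1) := by
  apply ContinuousOn.log (by fun_prop)
  intro x hx
  rw [Set.uIcc_of_le (by norm_num)] at hx
  have hx0 := hx.1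
  positivity

lemma GK_cont (n : ℕ) : ContinuousOn (GK n) (Set.uIcc 0 1) := by
  unfold GK
  apply ContinuousOn.sub (by fun_prop)
  exact continuousOn_finsetSum _ fun m _ => GK_term_cont m

lemma GK_int (n : ℕ) : ∫ x in (0:ℝ)..1, Real.sin (2*π*x) * GK n x =
    (1/(2*π)) * (-Real.log n + ∫ u in (2*π)..(2*π*(n+1:ℕ)), hK u) := by
  have e : ∀ x, Real.sin (2*π*x) * GK n x = (Real.sin (2*π*x) * x) * Real.log n +
      Real.sin (2*π*x) * Real.log n.factorial -
      ∑ m ∈ Finset.range n, Real.sin (2*π*x) * Real.log (x + (m+1)) := by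
    intro x; rw [GK, ← Finset.mul_sum]; ring
  have j0 : ∀ m ∈ Finset.range n, IntervalIntegrable
      (fun x => Real.sin (2*π*x) * Real.log (x + (m+1))) volume 0 1 := fun m _ =>
    ContinuousOn.intervalIntegrable
      ((by fun_prop : ContinuousOn (fun x => Real.sin (2*π*x)) _).mul (GK_term_cont m))
  have j1 : IntervalIntegrable (fun x => (Real.sin (2*π*x) * x) * Real.log n) volume 0 1 :=
    Continuous.intervalIntegrable (by fun_prop) _ _
  have j2 : IntervalIntegrable (fun x => Real.sin (2*π*x) * Real.log n.factorial) volume 0 1 :=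
    Continuous.intervalIntegrable (by fun_prop) _ _
  simp_rw [e]
  have j3 : IntervalIntegrable (fun x => ∑ m ∈ Finset.range n,
      Real.sin (2*π*x) * Real.log (x + (m+1))) volume 0 1 := by
    apply ContinuousOn.intervalIntegrable
    exact continuousOn_finsetSum _ fun m _ =>
      ((by fun_prop : ContinuousOn (fun x => Real.sin (2*π*x)) _).mul (GK_term_cont m))
  rw [intervalIntegral.integral_sub (j1.add j2) j3,
    intervalIntegral.integral_add j1 j2, intervalIntegral.integral_mul_const,
    intervalIntegral.integral_mul_const, x_sin, sin_zero_int,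
    intervalIntegral.integral_finsetSum j0]
  simp_rw [log_term]
  rw [← Finset.mul_sum]
  have := intervalIntegral.sum_integral_adjacent_intervals (f := hK) (μ := volume)
    (a := fun m : ℕ => 2*π*(m+1:ℕ)) (n := n) (fun k _ => hK_cont.intervalIntegrable _ _)
  rw [this]
  simp
  ring

lemma GK_bound (n : ℕ) (hn : n ≠ 0) (x : ℝ) (hx : 0 < x) (hx1 : x ≤ 1) :
    |Real.log (Real.Gamma (x+1)) - GK n x| ≤ Real.log (n+1) - Real.log n := by
  have feq : ∀ {y : ℝ}, 0 < y → (Real.log ∘ Real.Gamma) (y+1) =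
      (Real.log ∘ Real.Gamma) y + Real.log y := by
    intro y hy
    simp only [Function.comp]
    rw [Real.Gamma_add_one hy.ne', Real.log_mul hy.ne' (Real.Gamma_pos_of_pos hy).ne', add_comm]
  have h1 := Real.BohrMollerup.le_logGammaSeq Real.convexOn_log_Gamma @feq hx hx1 n
  have h2 := Real.BohrMollerup.ge_logGammaSeq Real.convexOn_log_Gamma @feq hx hn
  have h3 := feq hx
  have h4 : GK n x = Real.BohrMollerup.logGammaSeq x n + Real.log x := by
    rw [GK, Real.BohrMollerup.logGammaSeq, Finset.sum_range_succ']
    simp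
    ring
  simp only [Function.comp, Real.Gamma_one, Real.log_one] at h1 h2 h3
  have hn' : (0:ℝ) < n := by positivity
  have h5 : Real.log n ≤ Real.log (n+1) := Real.log_le_log hn' (by linarith)
  rw [h3, h4, abs_le]
  constructor
  · nlinarith
  · nlinarith

theorem integral_sin_log_Gamma :
    ∫ x in (0:ℝ)..1, Real.sin (2 * π * x) * Real.log (Real.Gamma (x + 1)) =
      Ci (2 * π) / (2 * π) := by
  have cG : ContinuousOn (fun x : ℝ => Real.log (Real.Gamma (x+1))) (Set.uIcc 0 1) := by
    intro x hx
    rw [Set.uIcc_of_le (by norm_num)] at hx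
    have hx0 : 0 < x + 1 := by linarith [hx.1]
    apply ContinuousAt.continuousWithinAt
    refine ContinuousAt.log (f := fun x : ℝ => Real.Gamma (x+1)) ?_ (Real.Gamma_pos_of_pos hx0).ne'
    have : ContinuousAt Real.Gamma (x+1) := 
      (Real.differentiableAt_Gamma fun m => by
        have : (0:ℝ) ≤ m := Nat.cast_nonneg m
        linarith).continuousAt
    exact ContinuousAt.comp (f := fun x : ℝ => x + 1) this (by fun_prop)
  have sc : ContinuousOn (fun x => Real.sin (2*π*x)) (Set.uIcc 0 1) := by fun_prop
  have i1 : IntervalIntegrable (fun x => Real.sin (2*π*x) * Real.log (Real.Gamma (x+1))) volume 0 1 :=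
    (sc.mul cG).intervalIntegrable
  have i2 (n : ℕ) : IntervalIntegrable (fun x => Real.sin (2*π*x) * GK n x) volume 0 1 :=
    (sc.mul (GK_cont n)).intervalIntegrable
  have lim1 : Filter.Tendsto (fun n : ℕ => ∫ x in (0:ℝ)..1, Real.sin (2*π*x) * GK n x) Filter.atTop
      (nhds (∫ x in (0:ℝ)..1, Real.sin (2 * π * x) * Real.log (Real.Gamma (x + 1)))) := by
    rw [tendsto_iff_norm_sub_tendsto_zero]
    refine squeeze_zero' (Filter.Eventually.of_forall fun n => norm_nonneg _) ?_
      Real.tendsto_log_nat_add_one_sub_log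
    filter_upwards [Filter.eventually_ne_atTop 0] with n hn
    rw [norm_sub_rev, ← intervalIntegral.integral_sub i1 (i2 n)]
    have := intervalIntegral.norm_integral_le_of_norm_le_const (a := (0:ℝ)) (b := 1)
      (f := fun x => Real.sin (2*π*x) * Real.log (Real.Gamma (x+1)) - Real.sin (2*π*x) * GK n x)
      (C := Real.log (n+1) - Real.log n) ?_
    · simpa using this
    · intro x hx
      rw [Set.uIoc_of_le (by norm_num)] at hx
      have hb := GK_bound n hn x hx.1 hx.2
      rw [← mul_sub, norm_mul, Real.norm_eq_abs, Real.norm_eq_abs]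
      calc _ ≤ 1 * |Real.log (Real.Gamma (x+1)) - GK n x| := by
            gcongr; exact Real.abs_sin_le_one _
        _ ≤ _ := by linarith
  have lim2 : Filter.Tendsto (fun n : ℕ => ∫ x in (0:ℝ)..1, Real.sin (2*π*x) * GK n x) Filter.atTop
      (nhds (Ci (2*π) / (2*π))) := by
    have a := (J_lim.comp (Filter.tendsto_add_atTop_nat 1)).add Real.tendsto_log_nat_add_one_sub_log
    have b := (a.add_const (Real.log (2*π) - ∫ u in (0:ℝ)..(2*π), hK u)).const_mul (1/(2*π))
    have e : (1/(2*π)) * (Real.eulerMascheroniConstant + 0 +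
        (Real.log (2*π) - ∫ u in (0:ℝ)..(2*π), hK u)) = Ci (2*π) / (2*π) := by
      have : ∫ t in (0:ℝ)..(2*π), (Real.cos t - 1) / t = - ∫ u in (0:ℝ)..(2*π), hK u := by
        rw [← intervalIntegral.integral_neg]
        congr 1; funext t; rw [hK]; ring
      rw [Ci, this]; ring
    rw [e] at b
    refine b.congr fun n => ?_
    rw [GK_int, ← intervalIntegral.integral_interval_sub_left (a := 0) (b := 2*π*(n+1:ℕ))
      (c := 2*π) (hK_cont.intervalIntegrable _ _) (hK_cont.intervalIntegrable _ _)]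
    simp only [Function.comp]
    rw [Real.log_mul (by positivity) (by positivity)]
    push_cast
    ring
  exact tendsto_nhds_unique lim1 lim2
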